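/- Let N ⊴ G be finite groups, θ ∈ Irr(N) G-invariant, and suppose there is a subgroup H ≤ G with G = NH. Let D = N ∩ H and let φ ∈ Irr(D) be H-invariant. If T = G and the Clifford correspondents are set up via character restriction: writing θ_{K_ξ} = θ_ξ + R and φ_{D_ξ} = φ_ξ + S over a constituent ξ as in Clifford theory, and θ_D = eφ + pA + B where no irreducible constituent of B equals φ, then [(θ_ξ)_{D_ξ}, φ_ξ] ≡ e ≡ [θ_D, φ] (mod p). -/

import Mathlib

open scoped Pointwise

attribute [local instance] Classical.propDecidable

/-- The usual inner product of class functions/characters on a finite group. -/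
noncomputable def innerChar (G : Type*) [Group G] [Fintype G] (α β : G → ℂ) : ℂ :=
  (Fintype.card G : ℂ)⁻¹ * ∑ g : G, α g * (starRingEnd ℂ) (β g)

/-- `χ : G → ℂ` is the character of some finite-dimensional complex representation. -/
def IsChar (G : Type) [Group G] [Fintype G] (χ : G → ℂ) : Prop :=
  ∃ V : FDRep ℂ G, FDRep.character V = χ

/-- `χ` is an irreducible complex character of `G`. -/
def IsIrrChar (G : Type) [Group G] [Fintype G] (χ : G → ℂ) : Prop :=
  IsChar G χ ∧ innerChar G χ χ = 1

section Characters

open CategoryTheory Representation ComplexOrder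

theorem Representation.character_inv_eq_conj {G V : Type*} [Group G] [Finite G] [AddCommGroup V]
    [Module ℂ V] [FiniteDimensional ℂ V] (ρ : Representation ℂ G V) (h : G) :
    ρ.character h⁻¹ = starRingEnd ℂ (ρ.character h) := by
  classical
  have := Fintype.ofFinite G
  let b := Module.finBasis ℂ V
  let M : G → Matrix _ _ ℂ := fun g => LinearMap.toMatrix b b (ρ g)
  have hM : ∀ g g', M (g * g') = M g * M g' := fun g g' => by
    simp [M, ← LinearMap.toMatrix_mul]
  have hM1 : M 1 = 1 := by simp [M]
  have htr : ∀ g, ρ.character g = (M g).trace := fun g =>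
    LinearMap.trace_eq_matrix_trace ℂ b (ρ g)
  let P := ∑ g, (M g).conjTranspose * M g
  have hP : P.PosDef := by
    rw [show P = (M 1).conjTranspose * M 1 + ∑ g ∈ Finset.univ.erase 1, (M g).conjTranspose * M g
      from (Finset.add_sum_erase _ _ (Finset.mem_univ _)).symm]
    refine Matrix.PosDef.add_posSemidef (by simpa [hM1] using Matrix.PosDef.one) ?_
    exact Matrix.posSemidef_sum _ fun g _ => Matrix.posSemidef_conjTranspose_mul_self _
  have hinv : (M h).conjTranspose * P = P * M h⁻¹ := by
    have : P * M h⁻¹ = ∑ g, (M (g * h)).conjTranspose * M (g * h) * M h⁻¹ := by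
      rw [← Finset.sum_mul]
      congr 1
      exact (Fintype.sum_equiv (Equiv.mulRight h) _ _ fun _ => rfl).symm
    rw [this, Finset.mul_sum]
    refine Finset.sum_congr rfl fun g _ => ?_
    rw [mul_assoc, ← hM, mul_inv_cancel_right, hM, Matrix.conjTranspose_mul, mul_assoc]
  have hu : IsUnit P.det := (Matrix.isUnit_iff_isUnit_det P).1 hP.isUnit
  have : (M h).conjTranspose = P * M h⁻¹ * P⁻¹ := by
    rw [← hinv, Matrix.mul_nonsing_inv_cancel_right _ _ hu]
  rw [htr, htr, starRingEnd_apply, ← Matrix.trace_conjTranspose, this, Matrix.trace_mul_cycle,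
    Matrix.nonsing_inv_mul _ hu, one_mul]

theorem FDRep.character_inv_eq_conj {G : Type} [Group G] [Finite G] (V : FDRep ℂ G) (g : G) :
    V.character g⁻¹ = starRingEnd ℂ (V.character g) :=
  Representation.character_inv_eq_conj V.ρ g

theorem IsChar.map_inv {G : Type} [Group G] [Fintype G] {χ : G → ℂ} (h : IsChar G χ) (g : G) :
    χ g⁻¹ = starRingEnd ℂ (χ g) := by
  obtain ⟨V, rfl⟩ := h
  exact V.character_inv_eq_conj g

theorem IsChar.map_conj {G : Type} [Group G] [Fintype G] {χ : G → ℂ} (h : IsChar G χ) (g x : G) :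
    χ (g * x * g⁻¹) = χ x := by
  obtain ⟨V, rfl⟩ := h
  exact V.char_conj x g

theorem innerChar_character {G : Type} [Group G] [Fintype G] (V W : FDRep ℂ G) :
    innerChar G V.character W.character = Module.finrank ℂ (W ⟶ V) := by
  have := invertibleOfNonzero (NeZero.ne (Nat.card G : ℂ))
  rw [← FDRep.scalar_product_char_eq_finrank_equivariant, innerChar, Fintype.card_eq_nat_card]
  simp [FDRep.character_inv_eq_conj]

theorem IsChar.exists_innerChar_eq_natCast {G : Type} [Group G] [Fintype G] {χ ψ : G → ℂ}
    (hχ : IsChar G χ) (hψ : IsChar G ψ) : ∃ n : ℕ, innerChar G χ ψ = n := by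
  obtain ⟨V, rfl⟩ := hχ
  obtain ⟨W, rfl⟩ := hψ
  exact ⟨_, innerChar_character V W⟩

theorem simple_of_innerChar_eq_one {G : Type} [Group G] [Fintype G] {V : FDRep ℂ G}
    (h : innerChar G V.character V.character = 1) : Simple V := by
  rw [FDRep.simple_iff_end_is_rank_one]
  rw [innerChar_character] at h
  exact_mod_cast h

theorem IsIrrChar.eq_of_innerChar_ne_zero {G : Type} [Group G] [Fintype G] {χ ψ : G → ℂ}
    (hχ : IsIrrChar G χ) (hψ : IsIrrChar G ψ) (h : innerChar G χ ψ ≠ 0) : χ = ψ := by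
  obtain ⟨⟨V, rfl⟩, hV⟩ := hχ
  obtain ⟨⟨W, rfl⟩, hW⟩ := hψ
  have := simple_of_innerChar_eq_one hV
  have := simple_of_innerChar_eq_one hW
  rw [innerChar_character, FDRep.finrank_hom_simple_simple] at h
  have hi : Nonempty (W ≅ V) := by
    by_contra hn
    simp [hn] at h
  exact (FDRep.char_iso hi.some).symm

theorem IsIrrChar.map_one_ne_zero {G : Type} [Group G] [Fintype G] {χ : G → ℂ}
    (hχ : IsIrrChar G χ) : χ 1 ≠ 0 := by
  obtain ⟨⟨V, rfl⟩, hV⟩ := hχ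
  intro h
  rw [FDRep.char_one, Nat.cast_eq_zero] at h
  have : Subsingleton V := Module.finrank_zero_iff.1 h
  have h0 : V.character = 0 := by
    funext g
    simp [FDRep.character, Subsingleton.elim (V.ρ g) 0]
  simp [h0, innerChar] at hV

theorem FDRep.exists_eq_smul_of_commute {G : Type} [Group G] [Fintype G] (V : FDRep ℂ G)
    (hV : innerChar G V.character V.character = 1) (T : V →ₗ[ℂ] V)
    (hT : ∀ g, V.ρ g ∘ₗ T = T ∘ₗ V.ρ g) : ∃ c : ℂ, T = c • LinearMap.id := by
  have h1 : Module.finrank ℂ (invariants (linHom V.ρ V.ρ)) = 1 := by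
    rw [(Representation.linHom.invariantsEquivFDRepHom V V).finrank_eq]
    rw [innerChar_character] at hV
    exact_mod_cast hV
  have key : ∀ S : V →ₗ[ℂ] V, (∀ g, V.ρ g ∘ₗ S = S ∘ₗ V.ρ g) →
      S ∈ invariants (linHom V.ρ V.ρ) := by
    intro S hS
    rw [mem_invariants]
    intro g
    rw [linHom_apply, ← LinearMap.comp_assoc, hS, LinearMap.comp_assoc, ← Module.End.mul_eq_comp (V.ρ g),
      ← map_mul, mul_inv_cancel, map_one]
    rfl
  let i : invariants (linHom V.ρ V.ρ) := ⟨LinearMap.id, key _ fun g => rfl⟩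
  have hi : i ≠ 0 := by
    intro h
    have h' : (LinearMap.id : V →ₗ[ℂ] V) = 0 := congrArg Subtype.val h
    have : IsIrrChar G V.character := ⟨⟨V, rfl⟩, hV⟩
    apply this.map_one_ne_zero
    have h1 : V.ρ 1 = 0 := by rw [map_one]; exact h'
    rw [FDRep.character, h1, map_zero]
  obtain ⟨c, hc⟩ := (finrank_eq_one_iff_of_nonzero' i hi).1 h1 ⟨T, key T hT⟩
  exact ⟨c, (congrArg Subtype.val hc).symm⟩

theorem innerChar_add_left {G : Type} [Group G] [Fintype G] (α β γ : G → ℂ) :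
    innerChar G (α + β) γ = innerChar G α γ + innerChar G β γ := by
  simp only [innerChar, Pi.add_apply, add_mul, Finset.sum_add_distrib, mul_add]

theorem innerChar_smul_left {G : Type} [Group G] [Fintype G] (c : ℂ) (α β : G → ℂ) :
    innerChar G (c • α) β = c * innerChar G α β := by
  simp only [innerChar, Pi.smul_apply, smul_eq_mul, mul_assoc, ← Finset.mul_sum]
  ring

theorem innerChar_character_of_isIrreducible {G : Type} [Group G] [Fintype G] (V : FDRep ℂ G)
    (h : IsIrreducible V.ρ) : innerChar G V.character V.character = 1 := by
  have := invertibleOfNonzero (NeZero.ne (Nat.card G : ℂ))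
  have h1 := card_inv_mul_sum_char_mul_char_eq_finrank V.ρ V.ρ
  rw [IsIrreducible.finrank_intertwiningMap_self] at h1
  rw [innerChar, Fintype.card_eq_nat_card]
  simp only [← FDRep.character_inv_eq_conj]
  exact_mod_cast h1

theorem IsChar.exists_add_of_not_isIrreducible {G : Type} [Group G] [Fintype G] (V : FDRep ℂ G)
    (h0 : V.character 1 ≠ 0) (h : ¬ IsIrreducible V.ρ) :
    ∃ V₁ V₂ : FDRep ℂ G, Module.finrank ℂ V₁ < Module.finrank ℂ V ∧
      Module.finrank ℂ V₂ < Module.finrank ℂ V ∧ V.character = V₁.character + V₂.character := by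
  have hnt : Nontrivial V := by
    rw [FDRep.char_one, Nat.cast_ne_zero] at h0
    exact Module.nontrivial_of_finrank_pos (Nat.pos_of_ne_zero h0)
  have hsub : Nontrivial (Subrepresentation V.ρ) :=
    ⟨⊥, ⊤, fun h => bot_ne_top (congrArg Subrepresentation.toSubmodule h : (⊥ : Submodule ℂ V) = ⊤)⟩
  obtain ⟨p, hp⟩ : ∃ p : Subrepresentation V.ρ, p ≠ ⊥ ∧ p ≠ ⊤ := by
    by_contra! hc
    exact h ⟨fun p => or_iff_not_imp_left.2 (hc p)⟩
  have hss : IsSemisimpleRepresentation V.ρ := inferInstance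
  obtain ⟨q, hq⟩ := exists_isCompl p
  have hpq : IsCompl p.toSubmodule q.toSubmodule := by
    constructor
    · rw [disjoint_iff]
      exact congrArg Subrepresentation.toSubmodule hq.inf_eq_bot
    · rw [codisjoint_iff]
      exact congrArg Subrepresentation.toSubmodule hq.sup_eq_top
  have hpt : p.toSubmodule ≠ ⊤ := fun h => hp.2 (Subrepresentation.toSubmodule_injective h)
  have hqt : q.toSubmodule ≠ ⊤ := fun h => hp.1 (by
    have : q = ⊤ := Subrepresentation.toSubmodule_injective h
    simpa [this] using hq.inf_eq_bot)
  refine ⟨FDRep.of p.toRepresentation, FDRep.of q.toRepresentation,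
    Submodule.finrank_lt hpt, Submodule.finrank_lt hqt, ?_⟩
  funext g
  have hint := (DirectSum.isInternal_submodule_iff_isCompl
    (fun b : Bool => cond b p.toSubmodule q.toSubmodule) (i := true) (j := false) (by simp)
    (by ext b; cases b <;> simp)).2 hpq
  have := LinearMap.trace_eq_sum_trace_restrict hint (f := V.ρ g) (fun b => by
    cases b
    · exact q.apply_mem_toSubmodule g
    · exact p.apply_mem_toSubmodule g)
  rw [Fintype.sum_bool] at this
  exact this

/-- An additive property of class functions holds for a character as soon as it holds for all its
irreducible constituents. -/
theorem IsChar.of_constituents {G : Type} [Group G] [Fintype G] {Q : (G → ℂ) → Prop} (h0 : Q 0)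
    (hadd : ∀ α β, Q α → Q β → Q (α + β)) {χ : G → ℂ} (hχ : IsChar G χ)
    (h : ∀ η, IsIrrChar G η → innerChar G χ η ≠ 0 → Q η) : Q χ := by
  obtain ⟨V, rfl⟩ := hχ
  induction hn : Module.finrank ℂ V using Nat.strong_induction_on generalizing V with
  | _ n ih =>
  subst hn
  by_cases h1 : V.character 1 = 0
  · convert h0
    rw [FDRep.char_one, Nat.cast_eq_zero] at h1
    have : Subsingleton V := Module.finrank_zero_iff.1 h1
    funext g
    simp [FDRep.character, Subsingleton.elim (V.ρ g) 0]
  by_cases hirr : IsIrreducible V.ρ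
  · have hV := innerChar_character_of_isIrreducible V hirr
    exact h _ ⟨⟨V, rfl⟩, hV⟩ (by simp [hV])
  obtain ⟨V₁, V₂, hlt₁, hlt₂, heq⟩ := IsChar.exists_add_of_not_isIrreducible V h1 hirr
  rw [heq] at h ⊢
  have key : ∀ η, IsIrrChar G η → innerChar G V₁.character η ≠ 0 ∨ innerChar G V₂.character η ≠ 0 →
      Q η := by
    intro η hη hor
    refine h η hη ?_
    obtain ⟨a, ha⟩ := IsChar.exists_innerChar_eq_natCast ⟨V₁, rfl⟩ hη.1
    obtain ⟨b, hb⟩ := IsChar.exists_innerChar_eq_natCast ⟨V₂, rfl⟩ hη.1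
    rw [innerChar_add_left, ha, hb]
    rw [ha, hb] at hor
    norm_cast at hor ⊢
    omega
  exact hadd _ _ (ih _ hlt₁ V₁ (fun η hη hne => key η hη (Or.inl hne)) rfl)
    (ih _ hlt₂ V₂ (fun η hη hne => key η hη (Or.inr hne)) rfl)

end Characters

section Extension

variable {G : Type} [Group G] {K L : Subgroup G}

/-- Extension by zero of a function on a subgroup. -/
noncomputable def extendZero (K : Subgroup G) (χ : K → ℂ) (x : G) : ℂ :=
  if h : x ∈ K then χ ⟨x, h⟩ else 0

@[simp]
theorem extendZero_coe (χ : K → ℂ) (x : K) : extendZero K χ x = χ x := by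
  simp [extendZero]

theorem extendZero_of_mem (χ : K → ℂ) {x : G} (h : x ∈ K) : extendZero K χ x = χ ⟨x, h⟩ :=
  dif_pos h

theorem extendZero_of_notMem (χ : K → ℂ) {x : G} (h : x ∉ K) : extendZero K χ x = 0 :=
  dif_neg h

theorem extendZero_conj {χ : K → ℂ} {g : G}
    (hχ : ∀ (x : K) (h : g * x * g⁻¹ ∈ K), χ ⟨g * x * g⁻¹, h⟩ = χ x)
    (hg : ∀ x, g * x * g⁻¹ ∈ K ↔ x ∈ K) (x : G) :
    extendZero K χ (g * x * g⁻¹) = extendZero K χ x := by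
  by_cases hx : x ∈ K
  · rw [extendZero_of_mem _ hx, extendZero_of_mem _ ((hg x).2 hx)]
    exact hχ ⟨x, hx⟩ _
  · rw [extendZero_of_notMem _ hx, extendZero_of_notMem _ (mt (hg x).1 hx)]

theorem extendZero_add (α β : K → ℂ) :
    extendZero K (α + β) = extendZero K α + extendZero K β := by
  funext x
  by_cases hx : x ∈ K <;> simp [extendZero, hx]

theorem conj_mem_iff_of_mem {g : G} (hg : g ∈ K) (x : G) : g * x * g⁻¹ ∈ K ↔ x ∈ K := by
  rw [K.mul_mem_cancel_right (K.inv_mem hg), K.mul_mem_cancel_left hg]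

variable [Fintype G]

theorem IsChar.extendZero_conj {χ : K → ℂ} (hχ : IsChar K χ) {g : G} (hg : g ∈ K) (x : G) :
    extendZero K χ (g * x * g⁻¹) = extendZero K χ x :=
  _root_.extendZero_conj (fun x _ => hχ.map_conj ⟨g, hg⟩ x) (conj_mem_iff_of_mem hg) x

/-- The unnormalised inner product of functions on a finite group. -/
noncomputable def sumConj (P Q : G → ℂ) : ℂ := ∑ x, P x * starRingEnd ℂ (Q x)

theorem sum_subgroup_eq_sum (F : G → ℂ) (hF : ∀ x, x ∉ K → F x = 0) :
    ∑ x : K, F x = ∑ x, F x := by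
  rw [← Finset.sum_subtype (Finset.univ.filter (· ∈ K)) (by simp) F]
  exact Finset.sum_subset (Finset.subset_univ _) fun x _ hx => hF x (by simpa using hx)

theorem sumConj_extendZero (P : G → ℂ) (χ : K → ℂ) :
    sumConj P (extendZero K χ) = Fintype.card K * innerChar K (fun x => P x) χ := by
  rw [innerChar, mul_inv_cancel_left₀ (by simp), sumConj,
    ← sum_subgroup_eq_sum (K := K) _ fun x hx => by simp [extendZero_of_notMem _ hx]]
  simp

omit [Group G] in
theorem sumConj_comm (P Q : G → ℂ) : sumConj P Q = starRingEnd ℂ (sumConj Q P) := by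
  simp [sumConj, mul_comm]

/-- The action of the group-algebra element `∑ a l • l` on functions by left translation. -/
noncomputable def translateSum (a : L → ℂ) (P : G → ℂ) (x : G) : ℂ := ∑ l : L, a l * P (l * x)

theorem translateSum_add (a : L → ℂ) (P Q : G → ℂ) :
    translateSum a (P + Q) = translateSum a P + translateSum a Q := by
  funext x
  simp [translateSum, mul_add, Finset.sum_add_distrib]

theorem sumConj_translateSum {a : L → ℂ} (ha : ∀ l, a l⁻¹ = starRingEnd ℂ (a l)) (P Q : G → ℂ) :
    sumConj (translateSum a P) Q = sumConj P (translateSum a Q) := by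
  simp only [sumConj, translateSum, Finset.sum_mul, map_sum, Finset.mul_sum]
  rw [Finset.sum_comm, Finset.sum_comm (s := Finset.univ (α := G))]
  refine Fintype.sum_equiv (Equiv.inv L) _ _ fun l => ?_
  refine Fintype.sum_equiv (Equiv.mulLeft (l : G)) _ _ fun x => ?_
  simp [ha]
  ring

theorem IsIrrChar.exists_translateSum_eq_smul [hL : L.Normal] (hLK : L ≤ K) {χ : K → ℂ}
    (hχ : IsIrrChar K χ) {a : L → ℂ}
    (ha : ∀ k ∈ K, ∀ l : L, a ⟨k * l * k⁻¹, hL.conj_mem l l.2 k⟩ = a l) :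
    ∃ c : ℂ, translateSum a (extendZero K χ) = c • extendZero K χ ∧
      c * χ 1 = ∑ l : L, a l * χ ⟨l, hLK l.2⟩ := by
  obtain ⟨⟨V, rfl⟩, hV⟩ := hχ
  let T : V →ₗ[ℂ] V := ∑ l : L, a l • V.ρ ⟨l, hLK l.2⟩
  obtain ⟨c, hc⟩ := V.exists_eq_smul_of_commute hV T fun k => by
    simp only [T, ← Module.End.mul_eq_comp, Finset.mul_sum, Finset.sum_mul, mul_smul_comm,
      smul_mul_assoc]
    refine Fintype.sum_equiv (MulAut.conjNormal (k : G)).toEquiv _ _ fun l => ?_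
    rw [show a ((MulAut.conjNormal (k : G)).toEquiv l) = a l from ha k k.2 l]
    simp only [← map_mul]
    congr 2
    ext
    simp
  have htr : ∀ x : K, ∑ l : L, a l * V.character (⟨l, hLK l.2⟩ * x) = c * V.character x := by
    intro x
    have := congrArg (fun S => LinearMap.trace ℂ V (S * V.ρ x)) hc
    simp only [T, Finset.sum_mul, smul_mul_assoc, ← map_mul, map_sum, map_smul, smul_eq_mul] at this
    exact this
  refine ⟨c, ?_, ?_⟩
  · funext x
    simp only [translateSum, Pi.smul_apply, smul_eq_mul]
    by_cases hx : x ∈ K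
    · rw [extendZero_of_mem _ hx, ← htr]
      exact Finset.sum_congr rfl fun l _ => by
        rw [extendZero_of_mem _ (K.mul_mem (hLK l.2) hx)]; rfl
    · rw [extendZero_of_notMem _ hx, mul_zero]
      refine Finset.sum_eq_zero fun l _ => ?_
      rw [extendZero_of_notMem _ (mt (K.mul_mem_cancel_left (hLK l.2)).1 hx), mul_zero]
  · rw [← htr]
    simp

theorem IsIrrChar.translateSum_eq_zero [hL : L.Normal] (hLK : L ≤ K) {χ : K → ℂ}
    (hχ : IsIrrChar K χ) {a : L → ℂ}
    (ha : ∀ k ∈ K, ∀ l : L, a ⟨k * l * k⁻¹, hL.conj_mem l l.2 k⟩ = a l)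
    (h : ∑ l : L, a l * χ ⟨l, hLK l.2⟩ = 0) : translateSum a (extendZero K χ) = 0 := by
  obtain ⟨c, hc, hc'⟩ := hχ.exists_translateSum_eq_smul hLK ha
  rw [h, mul_eq_zero, or_iff_left hχ.map_one_ne_zero] at hc'
  rw [hc, hc', zero_smul]

theorem IsIrrChar.exists_translateSum_eq_smul_ne_zero [hL : L.Normal] (hLK : L ≤ K) {χ : K → ℂ}
    (hχ : IsIrrChar K χ) {a : L → ℂ}
    (ha : ∀ k ∈ K, ∀ l : L, a ⟨k * l * k⁻¹, hL.conj_mem l l.2 k⟩ = a l)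
    (h : ∑ l : L, a l * χ ⟨l, hLK l.2⟩ ≠ 0) :
    ∃ c : ℂ, c ≠ 0 ∧ translateSum a (extendZero K χ) = c • extendZero K χ := by
  obtain ⟨c, hc, hc'⟩ := hχ.exists_translateSum_eq_smul hLK ha
  exact ⟨c, left_ne_zero_of_mul (hc' ▸ h), hc⟩

theorem sumConj_eq_zero_of_translateSum {a : L → ℂ} (ha : ∀ l, a l⁻¹ = starRingEnd ℂ (a l))
    {P Q : G → ℂ} {c : ℂ} (hc : c ≠ 0) (hP : translateSum a P = c • P)
    (hQ : translateSum a Q = 0) : sumConj Q P = 0 := by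
  have h : sumConj Q (c • P) = starRingEnd ℂ c * sumConj Q P := by
    simp only [sumConj, Finset.mul_sum, Pi.smul_apply, smul_eq_mul, map_mul]
    exact Finset.sum_congr rfl fun x _ => by ring
  rw [← hP, ← sumConj_translateSum ha, hQ] at h
  simpa [sumConj, hc] using h.symm

theorem translateSum_comp_eq_zero [hL : L.Normal] {ξ : L → ℂ} (hξ : IsIrrChar L ξ) {a : L → ℂ}
    (ha : ∀ k ∈ L, ∀ l : L, a ⟨k * l * k⁻¹, hL.conj_mem l l.2 k⟩ = a l)
    (h : ∑ l, a l * ξ l = 0) (P : G → ℂ) :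
    translateSum a (translateSum (fun l => starRingEnd ℂ (ξ l)) P) = 0 := by
  have h0 : ∀ m : L, ∑ l, a l * ξ (l * m) = 0 := fun m => by
    have := congrFun (hξ.translateSum_eq_zero le_rfl ha h) m
    simp only [translateSum, ← Subgroup.coe_mul, extendZero_coe] at this
    exact this
  funext x
  simp only [translateSum, Finset.mul_sum, Pi.zero_apply]
  have : ∀ l : L, ∑ m : L, a l * (starRingEnd ℂ (ξ m) * P (m * (l * x))) =
      ∑ m : L, a l * ξ (l * m⁻¹) * P (m * x) := fun l => by
    refine Fintype.sum_equiv (Equiv.mulRight l) _ _ fun m => ?_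
    rw [Equiv.coe_mulRight, mul_inv_rev, mul_inv_cancel_left, hξ.1.map_inv, Subgroup.coe_mul,
      mul_assoc (m : G), mul_assoc (a l)]
  simp_rw [this]
  rw [Finset.sum_comm]
  exact Finset.sum_eq_zero fun m _ => by rw [← Finset.sum_mul, h0, zero_mul]

omit [Group G] in
theorem eq_zero_of_sumConj_self_eq_zero {P : G → ℂ} (h : sumConj P P = 0) : P = 0 := by
  simp only [sumConj, Complex.mul_conj] at h
  rw [← Complex.ofReal_sum, Complex.ofReal_eq_zero,
    Finset.sum_eq_zero_iff_of_nonneg fun x _ => Complex.normSq_nonneg _] at h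
  exact funext fun x => Complex.normSq_eq_zero.1 (h x (Finset.mem_univ x))

theorem sumConj_conj (g : G) (P Q : G → ℂ) :
    sumConj (fun x => P (g * x * g⁻¹)) (fun x => Q (g * x * g⁻¹)) = sumConj P Q :=
  Fintype.sum_equiv (MulAut.conj g).toEquiv _ _ fun _ => rfl

/-- Frobenius reciprocity for functions induced to a subgroup `D`. -/
theorem sumConj_sum_conj {D : Subgroup G} {P Q : G → ℂ}
    (hQ : ∀ g ∈ D, ∀ x, Q (g * x * g⁻¹) = Q x) :
    sumConj Q (fun x => ∑ g : D, P (g * x * (g : G)⁻¹)) = Fintype.card D * sumConj Q P := by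
  have h : ∀ g : D, sumConj Q (fun x => P (g * x * (g : G)⁻¹)) = sumConj Q P := fun g => by
    rw [← sumConj_conj (g : G) Q P]
    simp only [hQ g g.2]
  have : sumConj Q (fun x => ∑ g : D, P (g * x * (g : G)⁻¹)) =
      ∑ g : D, sumConj Q (fun x => P (g * x * (g : G)⁻¹)) := by
    simp only [sumConj, map_sum, Finset.mul_sum]
    exact Finset.sum_comm
  simp [this, h]

/-- If the conjugates of `ψ ∈ Irr(K)` by elements of `D` outside `K` are orthogonal to `ψ`, then an
irreducible character of `D` that contains `ψ` exactly once is induced from `ψ`. -/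
theorem IsIrrChar.sum_conj_eq {D : Subgroup G} {φ : D → ℂ} (hφ : IsIrrChar D φ) {ψ : K → ℂ}
    (hψ : IsIrrChar K ψ) (hKD : K ≤ D) (hφψ : sumConj (extendZero D φ) (extendZero K ψ) = Fintype.card K)
    (hperp : ∀ g ∈ D, g ∉ K →
      sumConj (fun x => extendZero K ψ (g * x * g⁻¹)) (extendZero K ψ) = 0) (x : G) :
    ∑ g : D, extendZero K ψ (g * x * (g : G)⁻¹) = Fintype.card K * extendZero D φ x := by
  set P := extendZero K ψ
  set Φ := extendZero D φ
  set f : G → ℂ := fun x => ∑ g : D, P (g * x * (g : G)⁻¹) with hf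
  have hfD : ∀ h ∈ D, ∀ x, f (h * x * h⁻¹) = f x := fun h hh x =>
    Fintype.sum_equiv (Equiv.mulRight (⟨h, hh⟩ : D)) _ _ fun g => by
      simp [mul_assoc]
  have hΦD : ∀ h ∈ D, ∀ x, Φ (h * x * h⁻¹) = Φ x := fun h hh x => hφ.1.extendZero_conj hh x
  have hPP : sumConj P P = Fintype.card K := by
    rw [sumConj_extendZero]
    simp [P, hψ.2]
  have hΦΦ : sumConj Φ Φ = Fintype.card D := by
    rw [sumConj_extendZero]
    simp [Φ, hφ.2]
  have hfP : sumConj f P = Fintype.card K * Fintype.card K := by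
    have h1 : sumConj f P = ∑ g : D, sumConj (fun x => P (g * x * (g : G)⁻¹)) P := by
      simp only [sumConj, hf, Finset.sum_mul]
      exact Finset.sum_comm
    have h2 : ∀ g : D, sumConj (fun x => P (g * x * (g : G)⁻¹)) P =
        if (g : G) ∈ K then (Fintype.card K : ℂ) else 0 := fun g => by
      split_ifs with hg
      · simp only [P, hψ.1.extendZero_conj hg]
        exact hPP
      · exact hperp g g.2 hg
    rw [h1, Finset.sum_congr rfl fun g _ => h2 g,
      sum_subgroup_eq_sum (K := D) (fun g => if g ∈ K then (Fintype.card K : ℂ) else 0)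
        fun g hg => if_neg (mt (@hKD g) hg),
      ← sum_subgroup_eq_sum (K := K) _ fun g hg => if_neg hg]
    simp
  have hff : sumConj f f = Fintype.card D * (Fintype.card K * Fintype.card K) := by
    rw [← hfP]
    exact sumConj_sum_conj hfD
  have hΦf : sumConj Φ f = Fintype.card D * Fintype.card K := by
    rw [← hφψ]
    exact sumConj_sum_conj hΦD
  have hfΦ : sumConj f Φ = Fintype.card D * Fintype.card K := by
    rw [sumConj_comm, hΦf]
    simp
  have hexp : sumConj (fun x => f x - Fintype.card K * Φ x) (fun x => f x - Fintype.card K * Φ x) =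
      sumConj f f - Fintype.card K * sumConj f Φ - Fintype.card K * sumConj Φ f
        + Fintype.card K * Fintype.card K * sumConj Φ Φ := by
    simp only [sumConj, Finset.mul_sum, ← Finset.sum_sub_distrib, ← Finset.sum_add_distrib]
    exact Finset.sum_congr rfl fun x _ => by
      simp only [map_sub, map_mul, Complex.conj_natCast]
      ring
  rw [hff, hΦf, hfΦ, hΦΦ] at hexp
  have := congrFun (eq_zero_of_sumConj_self_eq_zero (hexp.trans (by ring))) x
  exact sub_eq_zero.1 this

theorem IsIrrChar.comp_conjNormal [L.Normal] {ξ : L → ℂ} (hξ : IsIrrChar L ξ) (g : G) :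
    IsIrrChar L (fun l => ξ (MulAut.conjNormal g l)) := by
  obtain ⟨⟨V, rfl⟩, hV⟩ := hξ
  refine ⟨⟨FDRep.of (V.ρ.comp (MulAut.conjNormal g : MulAut L).toMonoidHom), rfl⟩, ?_⟩
  rw [← hV]
  simp only [innerChar]
  congr 1
  exact Fintype.sum_equiv (MulAut.conjNormal g : MulAut L).toEquiv _ _ fun _ => rfl

theorem translateSum_conj [L.Normal] (a : L → ℂ) (P : G → ℂ) (g x : G) :
    translateSum (fun l => a (MulAut.conjNormal g l)) (fun x => P (g * x * g⁻¹)) x =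
      translateSum a P (g * x * g⁻¹) := by
  refine Fintype.sum_equiv (MulAut.conjNormal g : MulAut L).toEquiv _ _ fun l => ?_
  simp [mul_assoc]

/-- Conjugates of a function in the `ξ`-isotypic part by elements moving `ξ` are orthogonal to it. -/
theorem sumConj_conj_eq_zero [hL : L.Normal] {ξ : L → ℂ} (hξ : IsIrrChar L ξ) {P : G → ℂ} {c : ℂ}
    (hc : c ≠ 0) (hP : translateSum (fun l => starRingEnd ℂ (ξ l)) P = c • P) {g : G}
    (hg : ¬ ∀ l, ξ (MulAut.conjNormal g l) = ξ l) :
    sumConj (fun x => P (g * x * g⁻¹)) P = 0 := by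
  have hξg := hξ.comp_conjNormal g
  have hQ : translateSum (fun l => starRingEnd ℂ (ξ (MulAut.conjNormal g l)))
      (fun x => P (g * x * g⁻¹)) = c • fun x => P (g * x * g⁻¹) := by
    funext x
    rw [translateSum_conj (fun l => starRingEnd ℂ (ξ l)), hP]
    rfl
  have horth : ∑ l, starRingEnd ℂ (ξ (MulAut.conjNormal g l)) * ξ l = 0 := by
    by_contra h
    refine hg fun l => (congrFun (hξ.eq_of_innerChar_ne_zero hξg ?_) l).symm
    simpa [innerChar, mul_comm] using h
  have hzero := translateSum_comp_eq_zero hξ (fun k hk l => congrArg (starRingEnd ℂ)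
    (hξg.1.map_conj ⟨k, hk⟩ l)) horth P
  rw [hP] at hzero
  have hPzero : translateSum (fun l => starRingEnd ℂ (ξ (MulAut.conjNormal g l))) P = 0 := by
    refine (smul_eq_zero_iff_right hc).1 (Eq.trans ?_ hzero)
    funext x
    simp only [translateSum, Pi.smul_apply, smul_eq_mul, Finset.mul_sum]
    exact Finset.sum_congr rfl fun l _ => by ring
  rw [sumConj_comm, sumConj_eq_zero_of_translateSum (fun l => ?_) hc hQ hPzero, map_zero]
  rw [map_inv, hξ.1.map_inv]

end Extension

theorem stmt_18 {G : Type} [Group G] [Fintype G] (p : ℕ) (hp : p.Prime)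
    (N H L D : Subgroup G) (hN : N.Normal) (hL : L.Normal)
    (hD : D = N ⊓ H) (hDN : D ≤ N) (hLD : L ≤ D)
    (hG : (N : Set G) * (H : Set G) = Set.univ)
    -- `θ ∈ Irr(N)` is `G`-invariant
    (θ : ↥N → ℂ) (hθ : IsIrrChar ↥N θ)
    (hθG : ∀ g : G, ∀ n : ↥N, θ ⟨g * ↑n * g⁻¹, hN.conj_mem ↑n n.2 g⟩ = θ n)
    -- `φ ∈ Irr(D)` is `H`-invariant
    (φ : ↥D → ℂ) (hφ : IsIrrChar ↥D φ)
    (hφH : ∀ h ∈ H, ∀ d : ↥D, ∀ hm : h * ↑d * h⁻¹ ∈ D, φ ⟨h * ↑d * h⁻¹, hm⟩ = φ d)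
    -- `ξ ∈ Irr(L)` lies under `φ`
    (ξ : ↥L → ℂ) (hξ : IsIrrChar ↥L ξ)
    (hξφ : innerChar ↥L (fun l => φ ⟨↑l, hLD l.2⟩) ξ ≠ 0)
    -- `Kξ`, `Dξ` are the inertia groups of `ξ` in `N` and in `D`
    (Kξ Dξ : Subgroup G)
    (hKξ : ∀ g : G, g ∈ Kξ ↔ g ∈ N ∧
      ∀ l : ↥L, ξ ⟨g * ↑l * g⁻¹, hL.conj_mem ↑l l.2 g⟩ = ξ l)
    (hDξ : ∀ g : G, g ∈ Dξ ↔ g ∈ D ∧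
      ∀ l : ↥L, ξ ⟨g * ↑l * g⁻¹, hL.conj_mem ↑l l.2 g⟩ = ξ l)
    (hKN : Kξ ≤ N) (hDξD : Dξ ≤ D) (hDK : Dξ ≤ Kξ) (hLK : L ≤ Kξ) (hLDξ : L ≤ Dξ)
    -- `θξ` is the Clifford correspondent of `θ` over `ξ`: `θ_{Kξ} = θξ + R`
    -- with `θξ` lying over `ξ` and no constituent of `R` lying over `ξ`
    (θξ : ↥Kξ → ℂ) (hθξ : IsIrrChar ↥Kξ θξ)
    (hθξξ : innerChar ↥L (fun l => θξ ⟨↑l, hLK l.2⟩) ξ ≠ 0)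
    (R : ↥Kξ → ℂ) (hR : IsChar ↥Kξ R)
    (hdecθ : (fun k : ↥Kξ => θ ⟨↑k, hKN k.2⟩) = θξ + R)
    (hRξ : ∀ η : ↥Kξ → ℂ, IsIrrChar ↥Kξ η → innerChar ↥Kξ R η ≠ 0 →
      innerChar ↥L (fun l => η ⟨↑l, hLK l.2⟩) ξ = 0)
    -- `φξ` is the Clifford correspondent of `φ` over `ξ`: `φ_{Dξ} = φξ + S`
    (φξ : ↥Dξ → ℂ) (hφξ : IsIrrChar ↥Dξ φξ)
    (hφξξ : innerChar ↥L (fun l => φξ ⟨↑l, hLDξ l.2⟩) ξ ≠ 0)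
    (S : ↥Dξ → ℂ) (hS : IsChar ↥Dξ S)
    (hdecφ : (fun d : ↥Dξ => φ ⟨↑d, hDξD d.2⟩) = φξ + S)
    (hSξ : ∀ η : ↥Dξ → ℂ, IsIrrChar ↥Dξ η → innerChar ↥Dξ S η ≠ 0 →
      innerChar ↥L (fun l => η ⟨↑l, hLDξ l.2⟩) ξ = 0)
    -- `θ_D = e·φ + p·A + B`, with no irreducible constituent of `B` equal to `φ`
    (e : ℕ) (A B : ↥D → ℂ) (hA : IsChar ↥D A) (hB : IsChar ↥D B)
    (hdecD : (fun d : ↥D => θ ⟨↑d, hDN d.2⟩) = (e : ℂ) • φ + (p : ℂ) • A + B)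
    (hBφ : innerChar ↥D B φ = 0) :
    ∃ m m' : ℕ,
      innerChar ↥Dξ (fun d => θξ ⟨↑d, hDK d.2⟩) φξ = m ∧
      innerChar ↥D (fun d : ↥D => θ ⟨↑d, hDN d.2⟩) φ = m' ∧
      (m : ZMod p) = (e : ZMod p) ∧ (e : ZMod p) = (m' : ZMod p) := by
  have hξinv : ∀ l : L, starRingEnd ℂ (ξ l⁻¹) = starRingEnd ℂ (starRingEnd ℂ (ξ l)) := fun l => by
    rw [hξ.1.map_inv]
  have hsum : ∀ α : L → ℂ, ∑ l, starRingEnd ℂ (ξ l) * α l = Fintype.card L * innerChar L α ξ := by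
    intro α
    rw [innerChar, mul_inv_cancel_left₀ (by simp)]
    simp [mul_comm]
  have hDinv : ∀ k ∈ Dξ, ∀ l : L, starRingEnd ℂ (ξ ⟨k * l * k⁻¹, hL.conj_mem l l.2 k⟩) =
      starRingEnd ℂ (ξ l) := fun k hk l => by rw [((hDξ k).1 hk).2 l]
  have hKinv : ∀ k ∈ Kξ, ∀ l : L, starRingEnd ℂ (ξ ⟨k * l * k⁻¹, hL.conj_mem l l.2 k⟩) =
      starRingEnd ℂ (ξ l) := fun k hk l => by rw [((hKξ k).1 hk).2 l]
  obtain ⟨c, hc, hP⟩ := hφξ.exists_translateSum_eq_smul_ne_zero (hL := hL) hLDξ hDinv (by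
    rw [hsum]
    exact mul_ne_zero (by simp) hφξξ)
  have hSφξ : innerChar Dξ S φξ = 0 := by
    by_contra h
    exact hφξξ (hSξ φξ hφξ h)
  have hφφξ : sumConj (extendZero D φ) (extendZero Dξ φξ) = Fintype.card Dξ := by
    have : (fun x : Dξ => extendZero D φ x) = φξ + S := by
      rw [← hdecφ]
      exact funext fun x => extendZero_of_mem φ (hDξD x.2)
    rw [sumConj_extendZero, this, innerChar_add_left, hφξ.2, hSφξ]
    simp
  have hind := hφ.sum_conj_eq hφξ hDξD hφφξ fun g hgD hg =>
    sumConj_conj_eq_zero hξ hc hP fun h => hg ((hDξ g).2 ⟨hgD, h⟩)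
  have hRzero : translateSum (fun l => starRingEnd ℂ (ξ l)) (extendZero Kξ R) = 0 := by
    refine IsChar.of_constituents
      (Q := fun R => translateSum (fun l => starRingEnd ℂ (ξ l)) (extendZero Kξ R) = 0)
      ?_ ?_ hR fun η hη h => ?_
    · funext x
      simp [translateSum, extendZero]
    · intro α β hα hβ
      rw [extendZero_add, translateSum_add, hα, hβ, add_zero]
    · refine hη.translateSum_eq_zero (hL := hL) hLK hKinv ?_
      rw [hsum, hRξ η hη h, mul_zero]
  have hRP : sumConj (extendZero Kξ R) (extendZero Dξ φξ) = 0 :=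
    sumConj_eq_zero_of_translateSum hξinv hc hP hRzero
  have hθP : sumConj (extendZero N θ) (extendZero Dξ φξ) =
      Fintype.card Dξ * innerChar Dξ (fun d => θξ ⟨d, hDK d.2⟩) φξ := by
    have : (fun x : Dξ => extendZero N θ x) =
        (fun d : Dξ => θξ ⟨d, hDK d.2⟩) + fun x : Dξ => extendZero Kξ R x := by
      funext x
      rw [Pi.add_apply, extendZero_of_mem R (hDK x.2), extendZero_of_mem θ (hKN (hDK x.2))]
      exact congrFun hdecθ ⟨x, hDK x.2⟩
    rw [sumConj_extendZero, this, innerChar_add_left, mul_add, ← sumConj_extendZero (extendZero Kξ R),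
      hRP, add_zero]
  have hfrob := sumConj_sum_conj (D := D) (P := extendZero Dξ φξ) (Q := extendZero N θ)
    fun g hg x => hθ.1.extendZero_conj (hDN hg) x
  have hθφ : sumConj (extendZero N θ) (extendZero D φ) =
      Fintype.card D * innerChar D (fun d => θ ⟨d, hDN d.2⟩) φ := by
    rw [sumConj_extendZero]
    congr 2
    exact funext fun d => extendZero_of_mem θ (hDN d.2)
  have hscale : sumConj (extendZero N θ) (fun x => ∑ g : D, extendZero Dξ φξ (g * x * (g : G)⁻¹)) =
      Fintype.card Dξ * sumConj (extendZero N θ) (extendZero D φ) := by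
    simp only [hind, sumConj, Finset.mul_sum, map_mul, Complex.conj_natCast]
    exact Finset.sum_congr rfl fun x _ => by ring
  have heq : innerChar Dξ (fun d => θξ ⟨d, hDK d.2⟩) φξ =
      innerChar D (fun d => θ ⟨d, hDN d.2⟩) φ := by
    rw [hscale, hθφ, hθP] at hfrob
    have h1 : (Fintype.card D : ℂ) ≠ 0 := by simp
    have h2 : (Fintype.card Dξ : ℂ) ≠ 0 := by simp
    refine (mul_left_cancel₀ (mul_ne_zero h1 h2) ?_).symm
    linear_combination hfrob
  obtain ⟨n, hn⟩ := hA.exists_innerChar_eq_natCast hφ.1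
  have hval : innerChar D (fun d => θ ⟨d, hDN d.2⟩) φ = ((e + p * n : ℕ) : ℂ) := by
    rw [hdecD, innerChar_add_left, innerChar_add_left, innerChar_smul_left, innerChar_smul_left,
      hφ.2, hn, hBφ]
    push_cast
    ring
  exact ⟨e + p * n, e + p * n, heq.trans hval, hval, by simp, by simp⟩
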